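/- arXiv:1004.2168 — 5 statements merged into one kernel-verified Lean document; each statement's English description precedes it below -/
import Mathlib

section
/- Let m be a positive integer with m ≡ 3 (mod 4), and let k be a positive integer with 4k < m. Then the Jacobi symbols satisfy (k/m) = (m/(m−4k)). -/
open Real

/-- The Dirichlet series `L_m(s) = ∑_{l odd, l ≥ 1} (-m/l) l^{-s}`, where `(-m/l)` is the
Jacobi symbol. -/
noncomputable def Lser (m : ℤ) (s : ℝ) : ℝ :=
  ∑' l : ℕ, if Odd l then (jacobiSym (-m) l : ℝ) * (l : ℝ) ^ (-s) else 0

/-- The constant `K_m`: `1/2` for `m = 1` and `1` otherwise. -/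
noncomputable def Kc (m : ℕ) : ℝ := if m = 1 then 1 / 2 else 1

/-- The generalized Euler and class numbers `c_{m,n}`. -/
noncomputable def cNum (m n : ℕ) : ℝ :=
  (Nat.factorial (2 * n) : ℝ) * Lser (m : ℤ) (2 * n + 1) * (Kc m * Real.sqrt m)⁻¹ *
    (π / (2 * m)) ^ (-(2 * (n : ℤ) + 1))

/-- The generalized Euler and class numbers `d_{m,n}` (for `n ≥ 1`). -/
noncomputable def dNum (m n : ℕ) : ℝ :=
  (Nat.factorial (2 * n - 1) : ℝ) * Lser (-(m : ℤ)) (2 * n) * (Kc m * Real.sqrt m)⁻¹ *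
    (π / (2 * m)) ^ (-(2 * (n : ℤ)))

/-- The exponential generating function `s_m(x) = c_m(x) + d_m(x)`. -/
noncomputable def sgen (m : ℕ) (x : ℝ) : ℝ :=
  (∑' n : ℕ, cNum m n * x ^ (2 * n) / (Nat.factorial (2 * n) : ℝ)) +
  ∑' n : ℕ, dNum m (n + 1) * x ^ (2 * n + 1) / (Nat.factorial (2 * n + 1) : ℝ)

/-- `Λ_{m,p}(x) = (cos((m-p)x) + sin(px)) / cos(mx)`. -/
noncomputable def Lam (m p : ℤ) (x : ℝ) : ℝ :=
  (Real.cos (((m - p : ℤ) : ℝ) * x) + Real.sin ((p : ℝ) * x)) / Real.cos ((m : ℝ) * x)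

/-- The Fourier series `S_j(x) = ∑_{k ≥ 0} sin(2π(2k+1)x)/(2k+1)^j`. -/
noncomputable def Sser (j : ℕ) (x : ℝ) : ℝ :=
  ∑' k : ℕ, Real.sin (2 * π * (2 * (k : ℝ) + 1) * x) / (2 * (k : ℝ) + 1) ^ j

/-- The Fourier series `C_j(x) = ∑_{k ≥ 0} cos(2π(2k+1)x)/(2k+1)^j`. -/
noncomputable def Cser (j : ℕ) (x : ℝ) : ℝ :=
  ∑' k : ℕ, Real.cos (2 * π * (2 * (k : ℝ) + 1) * x) / (2 * (k : ℝ) + 1) ^ j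

theorem stmt10 (m k : ℕ) (hm : m % 4 = 3) (hk : 0 < k) (hkm : 4 * k < m) :
    jacobiSym (k : ℤ) m = jacobiSym (m : ℤ) (m - 4 * k) := by
  have hm_odd : Odd m := Nat.odd_iff.mpr (by omega)
  have hcong : ((m - 4 * k : ℕ) : ℤ) % m = (-(4 * (k : ℤ))) % m := by
    rw [Nat.cast_sub hkm.le]
    push_cast
    rw [show (m : ℤ) - 4 * k = -(4 * k) + m by ring, Int.add_emod_right]
  rw [jacobiSym.quadratic_reciprocity_three_mod_four hm (by omega : (m - 4 * k) % 4 = 3),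
    jacobiSym.mod_left' hcong, jacobiSym.neg _ hm_odd, ZMod.χ₄_nat_three_mod_four hm,
    jacobiSym.mul_left, jacobiSym.at_four hm_odd]
  ring
end

section
/- Let m be a positive integer with m ≡ 3 (mod 4), and let k be a positive integer with m < 4k < 2m. Then the Jacobi symbols satisfy (k/m) = (m/(4k−m)). -/
open Real

theorem stmt11 (m k : ℕ) (hm : m % 4 = 3) (hk : m < 4 * k) (hkm : 4 * k < 2 * m) :
    jacobiSym (k : ℤ) m = jacobiSym (m : ℤ) (4 * k - m) := by
  have hb : (4 * k - m) % 4 = 1 := by omega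
  have h_odd : Odd m := Nat.odd_iff.mpr (by omega)
  rw [← jacobiSym.quadratic_reciprocity_one_mod_four hb h_odd, Nat.cast_sub hk.le,
    jacobiSym.mod_left' (Int.sub_emod_right _ _)]
  push_cast
  rw [jacobiSym.mul_left, jacobiSym.at_four h_odd, one_mul]
end

section
/- Let m be a positive integer with m ≡ 1 (mod 4), and let k be a positive integer with 4k < m. Then the Jacobi symbols satisfy (k/m) = (−m/(m−4k)). -/
open Real

theorem stmt12 (m k : ℕ) (hm : m % 4 = 1) (hk : 0 < k) (hkm : 4 * k < m) :
    jacobiSym (k : ℤ) m = jacobiSym (-(m : ℤ)) (m - 4 * k) := by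
  have hn : (m - 4 * k) % 4 = 1 := by omega
  have hm_odd : Odd m := Nat.odd_iff.mpr (by omega)
  have hn_odd : Odd (m - 4 * k) := Nat.odd_iff.mpr (by omega)
  have hcongr : jacobiSym ((m - 4 * k : ℕ) : ℤ) m = jacobiSym (-(4 * (k : ℤ))) m := by
    apply jacobiSym.mod_left'
    rw [Nat.cast_sub hkm.le]
    push_cast
    rw [show (m : ℤ) - 4 * k = -(4 * (k : ℤ)) + m by ring, Int.add_emod_right]
  rw [jacobiSym.neg _ hn_odd, ZMod.χ₄_nat_one_mod_four hn, one_mul,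
    jacobiSym.quadratic_reciprocity_one_mod_four hm hn_odd, hcongr,
    jacobiSym.neg _ hm_odd, ZMod.χ₄_nat_one_mod_four hm, one_mul,
    jacobiSym.mul_left, jacobiSym.at_four hm_odd, one_mul]
end

section
/- Let m be a positive integer with m ≡ 1 (mod 4), and let k be a positive integer with m < 4k < 2m. Then the Jacobi symbols satisfy −(k/m) = (−m/(4k−m)). -/
open Real

theorem stmt13 (m k : ℕ) (hm : m % 4 = 1) (hk : m < 4 * k) (hkm : 4 * k < 2 * m) :
    -jacobiSym (k : ℤ) m = jacobiSym (-(m : ℤ)) (4 * k - m) := by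
  have hb : (4 * k - m) % 4 = 3 := by omega
  have hmo : Odd m := Nat.odd_iff.mpr (by omega)
  have hbo : Odd (4 * k - m) := Nat.odd_iff.mpr (by omega)
  have hcast : ((4 * k - m : ℕ) : ℤ) = 4 * k - m := by omega
  have hmod : jacobiSym ((4 * k - m : ℕ) : ℤ) m = jacobiSym (4 * k) m :=
    jacobiSym.mod_left' (by rw [hcast, Int.sub_emod_right])
  rw [jacobiSym.neg _ hbo, ZMod.χ₄_nat_three_mod_four hb,
    jacobiSym.quadratic_reciprocity_one_mod_four hm hbo, hmod, jacobiSym.mul_left,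
    jacobiSym.at_four hmo]
  ring
end

section
/- Let m be a positive integer with m ≡ 2 (mod 4), and let k be an odd integer with 1 ≤ k < m. Then the Jacobi symbols satisfy (−m/k) = (m/(m−k)). -/
open Real

theorem stmt14 (m k : ℕ) (hm : m % 4 = 2) (hk : 1 ≤ k) (hkm : k < m) (hkodd : Odd k) :
    jacobiSym (-(m : ℤ)) k = jacobiSym (m : ℤ) (m - k) := by
  obtain ⟨l, rfl⟩ : ∃ l, m = k + l := ⟨m - k, by omega⟩
  have hk2 : k % 2 = 1 := Nat.odd_iff.mp hkodd
  have hlodd : Odd l := Nat.odd_iff.mpr (by omega)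
  have hleft : jacobiSym (-((k + l : ℕ) : ℤ)) k = jacobiSym (-(l : ℤ)) k :=
    jacobiSym.mod_left' (by push_cast; rw [neg_add, add_comm]; simp [← sub_eq_add_neg])
  have hright : jacobiSym ((k + l : ℕ) : ℤ) l = jacobiSym (k : ℤ) l :=
    jacobiSym.mod_left' (by push_cast; simp)
  rw [Nat.add_sub_cancel_left, hleft, hright, jacobiSym.neg _ hkodd]
  rcases Nat.odd_mod_four_iff.mp hk2 with h | h
  · rw [ZMod.χ₄_nat_one_mod_four h, one_mul, jacobiSym.quadratic_reciprocity_one_mod_four h hlodd]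
  · rw [ZMod.χ₄_nat_three_mod_four h,
      jacobiSym.quadratic_reciprocity_three_mod_four h (by omega : l % 4 = 3), neg_one_mul]
end
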